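/- Let F contain a primitive p-th root of unity, let a, b ∈ F^× be linearly independent modulo (F^×)^p, let k < p be a positive integer, and assume χ_a ∪ χ_b is the coboundary of a continuous 1-cochain on G_F. Then there exists a complete defining system {a_{ij} : 1 ≤ i < j ≤ k+3} for the (k+2)-tuple (−χ_a, −χ_b, −χ_a, …, −χ_a) (k+1 copies of −χ_a) such that a_{ij} = −(χ_a choose j−i) for all 3 ≤ i < j ≤ k+3; in particular the (k+2)-fold Massey product ⟨−χ_a, −χ_b, −χ_a, …, −χ_a⟩ is defined and contains 0. -/

import Mathlib

/-- `(x choose m) = x(x−1)⋯(x−m+1)/m!` computed in `ZMod p`. -/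
noncomputable def zchoose {p : ℕ} [Fact p.Prime] (x : ZMod p) (m : ℕ) : ZMod p :=
  (∏ j ∈ Finset.range m, (x - (j : ZMod p))) / (m.factorial : ZMod p)

/-- Continuity of a map from a topological space to `ZMod p`, the latter regarded
as a discrete space: all fibers are open. -/
def Cts {G : Type*} [TopologicalSpace G] {p : ℕ} (f : G → ZMod p) : Prop :=
  ∀ x : ZMod p, IsOpen (f ⁻¹' {x})

/-- `M = {M i j : 1 ≤ i < j ≤ n+1}` is a complete defining system for the `n`-tuple
`(a 1, …, a n)`. -/
def IsCompleteDefiningSystem {G : Type*} [Group G] [TopologicalSpace G] {p : ℕ}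
    (n : ℕ) (a : ℕ → G → ZMod p) (M : ℕ → ℕ → G → ZMod p) : Prop :=
  (∀ i j, 1 ≤ i → i < j → j ≤ n + 1 → Cts (M i j)) ∧
  (∀ i, 1 ≤ i → i ≤ n → M i (i + 1) = a i) ∧
  (∀ i j, 1 ≤ i → i + 1 < j → j ≤ n + 1 → ∀ σ τ : G,
    M i j σ + M i j τ - M i j (σ * τ) = ∑ l ∈ Finset.Ico (i + 1) j, M i l σ * M l j τ)

/-- `χ` is the Kummer character attached to the `p`-th root `r`, with respect to the
primitive `p`-th root of unity `ξ` of `F`: `σ r = ξ^(χ σ) * r` for all `σ ∈ G_F`. -/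
def IsKummerChar {F Fs : Type*} [Field F] [Field Fs] [Algebra F Fs]
    {p : ℕ} (ξ : F) (r : Fs) (χ : (Fs ≃ₐ[F] Fs) → ZMod p) : Prop :=
  ∀ σ : Fs ≃ₐ[F] Fs, σ r = algebraMap F Fs ξ ^ (χ σ).val * r

/-- `a` and `b` are linearly independent modulo `(F^×)^p`. -/
def LinIndepModP (p : ℕ) {F : Type*} [Field F] (a b : F) : Prop :=
  ∀ m n : ℤ, (∃ y : F, y ≠ 0 ∧ a ^ m * b ^ n = y ^ (p : ℤ)) → (p : ℤ) ∣ m ∧ (p : ℤ) ∣ n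

theorem zchoose_zero {p : ℕ} [Fact p.Prime] (x : ZMod p) : zchoose x 0 = 1 := by
  simp [zchoose]

theorem zchoose_one {p : ℕ} [Fact p.Prime] (x : ZMod p) : zchoose x 1 = x := by
  simp [zchoose]

theorem zchoose_natCast {p : ℕ} [Fact p.Prime] (n : ℕ) {m : ℕ} (hm : m < p) :
    zchoose (n : ZMod p) m = (n.choose m : ZMod p) := by
  have hfac : (m.factorial : ZMod p) ≠ 0 := by
    rw [Ne, ZMod.natCast_eq_zero_iff, (Fact.out : p.Prime).dvd_factorial]
    omega
  rw [zchoose, ← descPochhammer_eval_eq_prod_range, descPochhammer_eval_eq_descFactorial,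
    div_eq_iff hfac, Nat.descFactorial_eq_factorial_mul_choose]
  push_cast
  ring

/-- The Chu–Vandermonde identity. -/
theorem zchoose_add {p : ℕ} [Fact p.Prime] (x y : ZMod p) {m : ℕ} (hm : m < p) :
    zchoose (x + y) m = ∑ l ∈ Finset.range (m + 1), zchoose x l * zchoose y (m - l) := by
  have hx : ((x.val : ℕ) : ZMod p) = x := ZMod.natCast_zmod_val x
  have hy : ((y.val : ℕ) : ZMod p) = y := ZMod.natCast_zmod_val y
  rw [← hx, ← hy, ← Nat.cast_add, zchoose_natCast _ hm, Nat.add_choose_eq,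
    Finset.Nat.sum_antidiagonal_eq_sum_range_succ_mk]
  push_cast
  refine Finset.sum_congr rfl fun l hl => ?_
  rw [Finset.mem_range] at hl
  rw [zchoose_natCast _ (by omega), zchoose_natCast _ (by omega)]

/-- The functional `f ↦ ∑ᵢ (-i choose j) f(i)` on functions `ZMod p → ZMod p`. -/
noncomputable def binomialMoment {p : ℕ} [Fact p.Prime] (j : ℕ) (f : ZMod p → ZMod p) : ZMod p :=
  ∑ i, zchoose (-i) j * f i

theorem binomialMoment_add {p : ℕ} [Fact p.Prime] (j : ℕ) (f g : ZMod p → ZMod p) :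
    binomialMoment j (fun i => f i + g i) = binomialMoment j f + binomialMoment j g := by
  simp [binomialMoment, mul_add, Finset.sum_add_distrib]

theorem binomialMoment_mul_left {p : ℕ} [Fact p.Prime] (j : ℕ) (c : ZMod p)
    (f : ZMod p → ZMod p) : binomialMoment j (fun i => c * f i) = c * binomialMoment j f := by
  simp [binomialMoment, Finset.mul_sum, mul_left_comm]

theorem binomialMoment_zero {p : ℕ} [Fact p.Prime] (f : ZMod p → ZMod p) :
    binomialMoment 0 f = ∑ i, f i := by
  simp [binomialMoment, zchoose_zero]

theorem binomialMoment_shift {p : ℕ} [Fact p.Prime] {j : ℕ} (hj : j < p)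
    (f : ZMod p → ZMod p) (x : ZMod p) :
    binomialMoment j (fun i => f (i + x)) =
      ∑ l ∈ Finset.range j, binomialMoment l f * zchoose x (j - l) + binomialMoment j f := by
  have key : binomialMoment j (fun i => f (i + x)) =
      ∑ l ∈ Finset.range (j + 1), binomialMoment l f * zchoose x (j - l) := by
    unfold binomialMoment
    rw [← (Equiv.subRight x).sum_comp]
    simp only [Equiv.subRight_apply, sub_add_cancel, neg_sub', sub_neg_eq_add, zchoose_add _ _ hj,
      Finset.sum_mul]
    rw [Finset.sum_comm]
    refine Finset.sum_congr rfl fun l _ => Finset.sum_congr rfl fun i _ => by ring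
  rw [key, Finset.sum_range_succ, Nat.sub_self, zchoose_zero, mul_one]

theorem IsLocallyConstant.finset_sum {ι X Y : Type*} [TopologicalSpace X] [AddCommMonoid Y]
    (s : Finset ι) {f : ι → X → Y} (hf : ∀ i, IsLocallyConstant (f i)) :
    IsLocallyConstant fun x => ∑ i ∈ s, f i x := by
  classical
  induction s using Finset.induction_on with
  | empty => exact IsLocallyConstant.const (0 : Y)
  | insert a s ha ih =>
    simp only [Finset.sum_insert ha]
    exact (hf a).comp₂ ih (· + ·)

theorem Cts.isLocallyConstant {G : Type*} [TopologicalSpace G] {p : ℕ} {f : G → ZMod p}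
    (hf : Cts f) : IsLocallyConstant f :=
  (IsLocallyConstant.iff_exists_open f).2 fun x => ⟨f ⁻¹' {f x}, hf _, rfl, fun _ h => h⟩

theorem IsLocallyConstant.binomialMoment {p : ℕ} [Fact p.Prime] {X : Type*} [TopologicalSpace X]
    (j : ℕ) {f : ZMod p → X → ZMod p} (hf : ∀ i, IsLocallyConstant (f i)) :
    IsLocallyConstant fun x => binomialMoment j fun i => f i x :=
  IsLocallyConstant.finset_sum _ fun i => (hf i).comp (zchoose (-i) j * ·)

/-- A cocycle with values in functions on `ZMod p`, on which `G` acts by translation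
through `χ`, yields the required complete defining system. -/
theorem exists_completeDefiningSystem_of_cocycle {p : ℕ} [Fact p.Prime] {G : Type*} [Group G]
    [TopologicalSpace G] {χ ψ : G → ZMod p} (hχ : ∀ σ τ, χ (σ * τ) = χ σ + χ τ)
    (hχc : IsLocallyConstant χ) {m : ZMod p → G → ZMod p}
    (hm : ∀ i σ τ, m i (σ * τ) = m i τ + m (i + χ τ) σ)
    (hmc : ∀ i, IsLocallyConstant (m i)) (hsum : ∀ σ, ∑ i, m i σ = ψ σ)
    {k : ℕ} (hkp : k < p) :
    ∃ M : ℕ → ℕ → G → ZMod p,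
      IsCompleteDefiningSystem (k + 2) (fun i σ => if i = 2 then -ψ σ else -χ σ) M ∧
      ∀ i j, 3 ≤ i → i < j → j ≤ k + 3 → M i j = fun σ => -(zchoose (χ σ) (j - i)) := by
  set v : ℕ → G → ZMod p := fun j σ => binomialMoment j fun i => m i σ with hv
  set w : ℕ → G → ZMod p := fun j σ => binomialMoment j fun i => (i + χ σ) * m i σ with hw
  have v_mul : ∀ j < p, ∀ σ τ, v j (σ * τ) =
      v j τ + (∑ l ∈ Finset.range j, v l σ * zchoose (χ τ) (j - l) + v j σ) := by
    intro j hj σ τ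
    simp only [hv, hm, binomialMoment_add]
    rw [binomialMoment_shift hj (fun i => m i σ)]
  have w_mul : ∀ j < p, ∀ σ τ, w j (σ * τ) = w j τ + χ σ * v j τ +
      (∑ l ∈ Finset.range j, w l σ * zchoose (χ τ) (j - l) + w j σ) := by
    intro j hj σ τ
    have : (fun i => (i + χ (σ * τ)) * m i (σ * τ)) = fun i =>
        ((i + χ τ) * m i τ + χ σ * m i τ) + ((i + χ τ) + χ σ) * m (i + χ τ) σ := by
      funext i
      rw [hm, hχ]
      ring
    simp only [hw, hv, this, binomialMoment_add, binomialMoment_mul_left]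
    rw [binomialMoment_shift hj (fun i => (i + χ σ) * m i σ)]
  refine ⟨fun i j σ => if i = 1 then (if j = 2 then -χ σ else -w (j - 3) σ) else
    if i = 2 then -v (j - 3) σ else -zchoose (χ σ) (j - i), ⟨?_, ?_, ?_⟩, ?_⟩
  · intro i j hi hij hj x
    have hvc : IsLocallyConstant (v (j - 3)) := IsLocallyConstant.binomialMoment _ hmc
    have hwc : IsLocallyConstant (w (j - 3)) :=
      IsLocallyConstant.binomialMoment _ fun i => hχc.comp₂ (hmc i) fun a b => (i + a) * b
    dsimp only
    split_ifs
    · exact hχc.comp (fun a => -a) {x}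
    · exact hwc.comp (fun a => -a) {x}
    · exact hvc.comp (fun a => -a) {x}
    · exact hχc.comp (fun a => -zchoose a (j - i)) {x}
  · intro i hi hik
    funext σ
    by_cases h1 : i = 1
    · simp [h1]
    by_cases h2 : i = 2
    · simp [h2, hv, binomialMoment_zero, hsum]
    · simp [h1, h2, zchoose_one]
  · intro i j hi hij hj σ τ
    by_cases h1 : i = 1
    · subst h1
      obtain ⟨n, rfl⟩ : ∃ n, j = n + 3 := ⟨j - 3, by omega⟩
      rw [Finset.sum_eq_sum_Ico_succ_bot (by omega), Finset.sum_Ico_eq_sum_range]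
      have : ∀ l, ¬ (1 + 1 + 1 + l = 2) ∧ ¬ (1 + 1 + 1 + l = 1) ∧ 1 + 1 + 1 + l - 3 = l ∧
        n + 3 - (1 + 1 + 1 + l) = n - l := by omega
      simp only [this, if_true, if_false]
      simp [w_mul n (by omega)]
      ring
    by_cases h2 : i = 2
    · subst h2
      obtain ⟨n, rfl⟩ : ∃ n, j = n + 3 := ⟨j - 3, by omega⟩
      rw [Finset.sum_Ico_eq_sum_range]
      have : ∀ l, ¬ (2 + 1 + l = 2) ∧ ¬ (2 + 1 + l = 1) ∧ 2 + 1 + l - 3 = l ∧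
        n + 3 - (2 + 1 + l) = n - l := by omega
      simp only [this, if_true, if_false]
      simp [v_mul n (by omega)]
    · obtain ⟨n, rfl⟩ : ∃ n, j = i + (n + 2) := ⟨j - (i + 2), by omega⟩
      rw [Finset.sum_Ico_eq_sum_range]
      have : ∀ l, ¬ (i + 1 + l = 2) ∧ ¬ (i + 1 + l = 1) ∧ i + 1 + l - i = l + 1 ∧
        i + (n + 2) - (i + 1 + l) = n + 1 - l := by omega
      have h3 : i + (n + 2) - (i + 1) = n + 1 := by omega
      simp only [h1, h2, this, h3, if_false]
      have h4 : i + (n + 2) - i = n + 2 := by omega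
      rw [h4, hχ, zchoose_add _ _ (by omega), Finset.sum_range_succ, Finset.sum_range_succ']
      simp only [zchoose_zero, Nat.sub_self, Nat.sub_zero, neg_mul_neg]
      have h5 : ∀ l, n + 2 - (l + 1) = n + 1 - l := by omega
      simp only [h5]
      ring
  · intro i j hi _ _
    funext σ
    have h1 : i ≠ 1 := by omega
    have h2 : i ≠ 2 := by omega
    simp [h1, h2]

theorem apply_one_of_map_mul {G A : Type*} [Monoid G] [AddGroup A] {χ : G → A}
    (hχ : ∀ σ τ, χ (σ * τ) = χ σ + χ τ) : χ 1 = 0 := by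
  simpa using hχ 1 1

theorem apply_inv_of_map_mul {G A : Type*} [Group G] [AddGroup A] {χ : G → A}
    (hχ : ∀ σ τ, χ (σ * τ) = χ σ + χ τ) (σ : G) : χ σ⁻¹ = -χ σ := by
  rw [eq_neg_iff_add_eq_zero, ← hχ, inv_mul_cancel, apply_one_of_map_mul hχ]

theorem apply_pow_of_map_mul {G R : Type*} [Monoid G] [Ring R] {χ : G → R}
    (hχ : ∀ σ τ, χ (σ * τ) = χ σ + χ τ) (σ : G) (n : ℕ) : χ (σ ^ n) = n * χ σ := by
  induction n with
  | zero => simp [apply_one_of_map_mul hχ]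
  | succ n ih => rw [pow_succ, hχ, ih, Nat.cast_succ, add_one_mul]

/-- The additive character `c ↦ ξ ^ c` of `ZMod p`. -/
theorem exists_addChar_of_isPrimitiveRoot {p : ℕ} [Fact p.Prime] {F : Type*} [Field F] {ξ : F}
    (hξ : IsPrimitiveRoot ξ p) : ∃ e : AddChar (ZMod p) F, (∀ c, e c = ξ ^ c.val) ∧
      ∀ c, e c = 1 → c = 0 := by
  refine ⟨AddChar.zmodChar p hξ.pow_eq_one, fun c => rfl, fun c hc => ?_⟩
  rw [AddChar.zmodChar_apply] at hc
  exact (ZMod.val_eq_zero c).1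
    (Nat.eq_zero_of_dvd_of_lt (hξ.dvd_of_pow_eq_one _ hc) (ZMod.val_lt c))

/-- A Lagrange resolvent: a continuous character of an open subgroup `H` of the Galois group
with values in the roots of unity of the base field is a Kummer character. -/
theorem exists_eigenvector_of_character {p : ℕ} [Fact p.Prime] {F L : Type*} [Field F] [Field L]
    [Algebra F L] [IsGalois F L] (e : AddChar (ZMod p) F) (H : Subgroup (L ≃ₐ[F] L))
    (hH : IsOpen (H : Set (L ≃ₐ[F] L))) {φ : (L ≃ₐ[F] L) → ZMod p} (hφc : IsLocallyConstant φ)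
    (hφ : ∀ σ ∈ H, ∀ τ ∈ H, φ (σ * τ) = φ σ + φ τ) :
    ∃ γ : L, γ ≠ 0 ∧ ∀ σ ∈ H, σ γ = e (φ σ) • γ := by
  have hφH : ∀ σ τ : H, φ (σ * τ : H) = φ σ + φ τ := fun σ τ => hφ σ σ.2 τ τ.2
  have hone : φ 1 = 0 := apply_one_of_map_mul (χ := fun σ : H => φ σ) hφH
  have hpow : ∀ σ ∈ H, ∀ n : ℕ, φ (σ ^ n) = n * φ σ := fun σ hσ n =>
    apply_pow_of_map_mul (χ := fun σ : H => φ σ) hφH ⟨σ, hσ⟩ n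
  by_cases htriv : ∀ σ ∈ H, φ σ = 0
  · exact ⟨1, one_ne_zero, fun σ hσ => by simp [htriv σ hσ]⟩
  push Not at htriv
  obtain ⟨t₀, ht₀, ht₀'⟩ := htriv
  obtain ⟨t, ht, ht1⟩ : ∃ t ∈ H, φ t = 1 := by
    refine ⟨t₀ ^ ((φ t₀)⁻¹).val, H.pow_mem ht₀ _, ?_⟩
    rw [hpow _ ht₀, ZMod.natCast_zmod_val, inv_mul_cancel₀ ht₀']
  have htpow : ∀ c : ZMod p, φ (t ^ c.val) = c := fun c => by
    rw [hpow _ ht, ht1, ZMod.natCast_zmod_val, mul_one]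
  have hinv : ∀ σ ∈ H, φ σ⁻¹ = -φ σ := fun σ hσ =>
    apply_inv_of_map_mul (χ := fun σ : H => φ σ) hφH ⟨σ, hσ⟩
  let N : Subgroup (L ≃ₐ[F] L) :=
    { carrier := {σ | σ ∈ H ∧ φ σ = 0}
      one_mem' := ⟨H.one_mem, hone⟩
      mul_mem' := fun {σ τ} hσ hτ =>
        ⟨H.mul_mem hσ.1 hτ.1, by rw [hφ _ hσ.1 _ hτ.1, hσ.2, hτ.2, add_zero]⟩
      inv_mem' := fun {σ} hσ => ⟨H.inv_mem hσ.1, by rw [hinv _ hσ.1, hσ.2, neg_zero]⟩ }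
  have hN : IsOpen (N : Set (L ≃ₐ[F] L)) := hH.inter (hφc {0})
  have hfix : (IntermediateField.fixedField N).fixingSubgroup = N :=
    InfiniteGalois.fixingSubgroup_fixedField ⟨N, N.isClosed_of_isOpen hN⟩
  set E := IntermediateField.fixedField N
  have heq : ∀ σ ∈ H, ∀ τ ∈ H, φ σ = φ τ → ∀ x : E, σ (x : L) = τ (x : L) := by
    intro σ hσ τ hτ h x
    have hmem : τ⁻¹ * σ ∈ N := ⟨H.mul_mem (H.inv_mem hτ) hσ, by
      rw [hφ _ (H.inv_mem hτ) _ hσ, hinv _ hτ, h, neg_add_cancel]⟩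
    have hx : (τ⁻¹ * σ) (x : L) = x := x.2 ⟨_, hmem⟩
    rw [AlgEquiv.mul_apply] at hx
    calc σ (x : L) = (τ * τ⁻¹) (σ x) := by simp
      _ = τ x := by rw [AlgEquiv.mul_apply, hx]
  let f : ZMod p → (E →* L) := fun c =>
    ((t ^ c.val : L ≃ₐ[F] L) : L →* L).comp (algebraMap E L : E →* L)
  have hf : Function.Injective f := by
    intro c d hcd
    have hmem : (t ^ c.val)⁻¹ * t ^ d.val ∈ N := by
      rw [← hfix, IntermediateField.mem_fixingSubgroup_iff]
      intro x hx
      have hx' : (t ^ c.val) x = (t ^ d.val) x := DFunLike.congr_fun hcd ⟨x, hx⟩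
      rw [AlgEquiv.mul_apply, ← hx', ← AlgEquiv.mul_apply, inv_mul_cancel, AlgEquiv.one_apply]
    have := hφ _ (H.pow_mem ht c.val) _ hmem.1
    rw [hmem.2, mul_inv_cancel_left, htpow, htpow, add_zero] at this
    exact this.symm
  have hli := (linearIndependent_monoidHom E L).comp f hf
  have hne : ∃ x : E, ∑ c : ZMod p, e (-c) • (t ^ c.val) (x : L) ≠ 0 := by
    by_contra! hzero
    rw [Fintype.linearIndependent_iff] at hli
    have := hli (fun c => algebraMap F L (e (-c))) (by
      funext x
      simpa [Algebra.smul_def, f] using hzero x) 0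
    simp at this
  obtain ⟨x, hx⟩ := hne
  refine ⟨_, hx, fun σ hσ => ?_⟩
  rw [map_sum, Finset.smul_sum, ← (Equiv.subRight (φ σ)).sum_comp]
  refine Finset.sum_congr rfl fun c _ => ?_
  rw [map_smul, ← AlgEquiv.mul_apply, smul_smul, ← AddChar.map_add_eq_mul, Equiv.subRight_apply,
    heq _ (H.mul_mem hσ (H.pow_mem ht _)) _ (H.pow_mem ht c.val)
      (by rw [hφ _ hσ _ (H.pow_mem ht _), htpow, htpow]; ring)]
  congr 2
  ring

/-- If `χ ∪ ψ` is a coboundary, with `χ` nonzero and `ψ` the Kummer character of `r ^ p`, then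
`r ^ p` is a norm from the fixed field of the kernel of `χ`. -/
theorem exists_norm_eq_of_cup_eq_coboundary {p : ℕ} [Fact p.Prime] {F L : Type*} [Field F]
    [Field L] [Algebra F L] [IsGalois F L] (e : AddChar (ZMod p) F)
    {χ ψ φ : (L ≃ₐ[F] L) → ZMod p} (hχ : ∀ σ τ, χ (σ * τ) = χ σ + χ τ)
    (hχc : IsLocallyConstant χ) (hψ : ∀ σ τ, ψ (σ * τ) = ψ σ + ψ τ)
    {r : L} (hr0 : r ≠ 0) (hr : ∀ σ, σ r = e (ψ σ) • r) (hφc : IsLocallyConstant φ)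
    (hφ : ∀ σ τ, φ σ + φ τ - φ (σ * τ) = χ σ * ψ τ) {s : L ≃ₐ[F] L} (hs : χ s = 1) :
    ∃ β : L, β ≠ 0 ∧ (∀ σ, χ σ = 0 → σ β = β) ∧
      ∏ i ∈ Finset.range p, (s ^ i) β = r ^ p := by
  have hφ' : ∀ σ τ, φ (σ * τ) = φ σ + φ τ - χ σ * ψ τ := fun σ τ => by
    linear_combination -hφ σ τ
  have hχ1 : χ 1 = 0 := apply_one_of_map_mul hχ
  have hφ1 : φ 1 = 0 := by simpa [hχ1] using hφ' 1 1
  have hinv : ∀ σ, χ σ⁻¹ = -χ σ := apply_inv_of_map_mul hχ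
  let H : Subgroup (L ≃ₐ[F] L) :=
    { carrier := {σ | χ σ = 0}
      one_mem' := hχ1
      mul_mem' := fun {σ τ} hσ hτ => by
        rw [Set.mem_ofPred_eq] at *
        rw [hχ, hσ, hτ, add_zero]
      inv_mem' := fun {σ} hσ => by
        rw [Set.mem_ofPred_eq] at *
        rw [hinv, hσ, neg_zero] }
  obtain ⟨γ, hγ0, hγ⟩ := exists_eigenvector_of_character e H (hχc {0}) hφc fun σ hσ τ _ => by
    rw [hφ', show χ σ = 0 from hσ, zero_mul, sub_zero]
  have hχs : ∀ n : ℕ, χ (s ^ n) = n := fun n => by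
    rw [apply_pow_of_map_mul hχ, hs, mul_one]
  have hψs : ∀ n : ℕ, ψ (s ^ n) = n * ψ s := apply_pow_of_map_mul hψ s
  have hφs : ∀ n : ℕ, φ (s ^ n) = n * φ s - (∑ i ∈ Finset.range n, (i : ZMod p)) * ψ s := by
    intro n
    induction n with
    | zero => simp [hφ1]
    | succ n ih =>
      rw [pow_succ, hφ', ih, hχs, Finset.sum_range_succ]
      push_cast
      ring
  have hsmul : ∀ c (x : L), e c • x = algebraMap F L (e c) * x := fun c x => Algebra.smul_def _ _
  have hsγ : s γ ≠ 0 := by simpa using hγ0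
  have he0 : ∀ c, algebraMap F L (e c) ≠ 0 := fun c => by
    simpa using (e.val_isUnit c).ne_zero
  have headd : ∀ c d, algebraMap F L (e (c + d)) = algebraMap F L (e c) * algebraMap F L (e d) :=
    fun c d => by rw [AddChar.map_add_eq_mul, map_mul]
  refine ⟨r * γ / s γ, div_ne_zero (mul_ne_zero hr0 hγ0) hsγ, fun σ hσ => ?_, ?_⟩
  · have hχc : χ (s⁻¹ * σ * s) = 0 := by
      rw [hχ, hχ, hinv, hσ]
      ring
    have hψc : ψ (s⁻¹ * σ * s) = ψ σ := by
      have h1 := hψ s (s⁻¹ * σ * s)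
      have h2 := hψ σ s
      rw [show s * (s⁻¹ * σ * s) = σ * s by group] at h1
      linear_combination h2 - h1
    have hφc : φ (s⁻¹ * σ * s) = φ σ + ψ σ := by
      have h1 := hφ' s (s⁻¹ * σ * s)
      have h2 := hφ' σ s
      rw [show s * (s⁻¹ * σ * s) = σ * s by group, hψc, hs] at h1
      rw [hσ] at h2
      linear_combination h2 - h1
    have hσs : σ (s γ) = e (φ σ + ψ σ) • s γ := by
      rw [← hφc, ← map_smul, ← hγ _ hχc, ← AlgEquiv.mul_apply, ← AlgEquiv.mul_apply]
      congr 1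
      group
    rw [map_div₀, map_mul, hr, hγ σ hσ, hσs, hsmul, hsmul, hsmul, headd]
    have := he0 (φ σ)
    have := he0 (ψ σ)
    field_simp
  · have hsp : s ^ p ∈ H := by
      change χ (s ^ p) = 0
      rw [hχs, CharP.cast_eq_zero]
    have hprod : ∀ n : ℕ, ∏ i ∈ Finset.range n, (s ^ i) (r * γ / s γ) =
        algebraMap F L (e ((∑ i ∈ Finset.range n, (i : ZMod p)) * ψ s)) * r ^ n *
          (γ / (s ^ n) γ) := by
      intro n
      induction n with
      | zero => simp [hγ0]
      | succ n ih =>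
        have h1 : (s ^ n) γ ≠ 0 := (map_ne_zero _).2 hγ0
        have h2 : (s ^ (n + 1)) γ ≠ 0 := (map_ne_zero _).2 hγ0
        have h3 : (s ^ n) (s γ) = (s ^ (n + 1)) γ := by rw [pow_succ, AlgEquiv.mul_apply]
        rw [Finset.prod_range_succ, ih, map_div₀ (s ^ n), map_mul (s ^ n), hr, h3, hψs, Finset.sum_range_succ,
          add_mul, headd, hsmul]
        field_simp
        ring
    have hsum : (∑ i ∈ Finset.range p, (i : ZMod p)) * 2 = 0 := by
      have := congrArg (Nat.cast : ℕ → ZMod p) (Finset.sum_range_id_mul_two p)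
      push_cast at this
      rw [this, CharP.cast_eq_zero, zero_mul]
    rw [hprod, hγ _ hsp, hφs, CharP.cast_eq_zero, zero_mul, zero_sub, hsmul]
    set A := (∑ i ∈ Finset.range p, (i : ZMod p)) * ψ s
    have hAA : A = -A := by linear_combination ψ s * hsum
    have h0 := he0 (-A)
    rw [← hAA] at h0 ⊢
    field_simp

/-- The `p`-th roots of the conjugates of `β` are permuted up to roots of unity, the roots of
unity forming a cocycle. -/
theorem exists_cocycle_of_norm_eq {p : ℕ} [Fact p.Prime] {F L : Type*} [Field F] [Field L]
    [Algebra F L] [IsSepClosure F L] (e : AddChar (ZMod p) F) (hp : (p : F) ≠ 0)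
    (hinj : ∀ c, e c = 1 → c = 0) (hroot : ∀ x y : L, y ≠ 0 → x ^ p = y ^ p → ∃ c, x = e c • y)
    {χ ψ : (L ≃ₐ[F] L) → ZMod p} (hχ : ∀ σ τ, χ (σ * τ) = χ σ + χ τ)
    (hχc : IsLocallyConstant χ) {r : L} (hr0 : r ≠ 0) (hr : ∀ σ, σ r = e (ψ σ) • r)
    {s : L ≃ₐ[F] L} (hs : χ s = 1) {β : L} (hβ0 : β ≠ 0) (hβ : ∀ σ, χ σ = 0 → σ β = β)
    (hnorm : ∏ i ∈ Finset.range p, (s ^ i) β = r ^ p) :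
    ∃ m : ZMod p → (L ≃ₐ[F] L) → ZMod p,
      (∀ i σ τ, m i (σ * τ) = m i τ + m (i + χ τ) σ) ∧
      (∀ i, IsLocallyConstant (m i)) ∧ ∀ σ, ∑ i, m i σ = ψ σ := by
  have : IsGalois F L := IsSepClosure.isGalois
  have : IsSepClosed L := IsSepClosure.sep_closed F
  have : NeZero (p : L) := ⟨by
    rw [← map_natCast (algebraMap F L)]
    exact (map_ne_zero _).2 hp⟩
  have hsmul : ∀ c (x : L), e c • x = algebraMap F L (e c) * x := fun c x => Algebra.smul_def _ _
  have hcancel : ∀ c d (x : L), x ≠ 0 → e c • x = e d • x → c = d := by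
    intro c d x hx h
    rw [hsmul, hsmul, mul_left_inj' hx, (algebraMap F L).injective.eq_iff] at h
    refine sub_eq_zero.1 (hinj _ ?_)
    rw [AddChar.map_sub_eq_div, h, div_self (e.val_isUnit d).ne_zero]
  have hβeq : ∀ σ τ, χ σ = χ τ → σ β = τ β := by
    intro σ τ h
    have h1 : χ (τ⁻¹ * σ) = 0 := by
      have := hχ τ (τ⁻¹ * σ)
      rw [mul_inv_cancel_left, h] at this
      linear_combination -this
    calc σ β = (τ * (τ⁻¹ * σ)) β := by rw [mul_inv_cancel_left]
      _ = τ β := by rw [AlgEquiv.mul_apply, hβ _ h1]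
  have hχs : ∀ c : ZMod p, χ (s ^ c.val) = c := fun c => by
    rw [apply_pow_of_map_mul hχ, hs, mul_one, ZMod.natCast_zmod_val]
  obtain ⟨δ₀, hδ₀⟩ := IsSepClosed.exists_pow_nat_eq β p
  have hδ₀0 : δ₀ ≠ 0 := by
    rintro rfl
    exact hβ0 (by rw [← hδ₀, zero_pow (Fact.out : p.Prime).ne_zero])
  let δ : ZMod p → L := fun i => (s ^ i.val) δ₀
  have hδ0 : ∀ i, δ i ≠ 0 := fun i => (map_ne_zero _).2 hδ₀0
  have hδp : ∀ i, δ i ^ p = (s ^ i.val) β := fun i => by rw [← hδ₀, map_pow]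
  have hex : ∀ i σ, ∃ c, σ (δ i) = e c • δ (i + χ σ) := by
    intro i σ
    refine hroot _ _ (hδ0 _) ?_
    rw [← map_pow, hδp, hδp, ← AlgEquiv.mul_apply]
    exact hβeq _ _ (by rw [hχ, hχs, hχs, add_comm])
  choose m hm using hex
  refine ⟨m, fun i σ τ => ?_, fun i => ?_, fun σ => ?_⟩
  · refine hcancel _ _ _ (hδ0 (i + χ (σ * τ))) ?_
    rw [← hm, AlgEquiv.mul_apply, hm, map_smul, hm, smul_smul, ← AddChar.map_add_eq_mul, hχ,
      add_assoc, add_comm (χ σ)]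
  · rw [IsLocallyConstant.iff_exists_open]
    intro σ
    refine ⟨(σ⁻¹ * ·) ⁻¹' (MulAction.stabilizer (L ≃ₐ[F] L) (δ i)) ∩ χ ⁻¹' {χ σ},
      ((stabilizer_isOpen_of_isIntegral (δ i)).preimage (continuous_const_mul σ⁻¹)).inter (hχc _),
      ⟨by simp, rfl⟩, ?_⟩
    rintro τ ⟨hτ, hτ'⟩
    have hτ : (σ⁻¹ * τ) (δ i) = δ i := hτ
    have hτ' : χ τ = χ σ := hτ'
    have hστ : τ (δ i) = σ (δ i) := by
      conv_rhs => rw [← hτ, ← AlgEquiv.mul_apply, mul_inv_cancel_left]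
    refine hcancel _ _ _ (hδ0 (i + χ σ)) ?_
    rw [← hm i σ, ← hτ', ← hm i τ, hστ]
  · have hprod : (∏ i, δ i) ^ p = r ^ p := by
      rw [← hnorm, ← Finset.prod_pow]
      simp only [hδp]
      refine Finset.prod_bij (fun i _ => i.val) (fun i _ => Finset.mem_range.2 (ZMod.val_lt i))
        (fun i _ j _ h => ZMod.val_injective p h)
        (fun n hn => ⟨n, Finset.mem_univ _, ZMod.val_cast_of_lt (Finset.mem_range.1 hn)⟩)
        fun i _ => rfl
    obtain ⟨c, hc⟩ := hroot _ _ hr0 hprod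
    have hne : ∏ i, δ i ≠ 0 := Finset.prod_ne_zero_iff.2 fun i _ => hδ0 i
    refine hcancel _ _ _ hne ?_
    have hsum : e (∑ i, m i σ) = ∏ i, e (m i σ) :=
      map_prod e.toMonoidHom (fun i => Multiplicative.ofAdd (m i σ)) Finset.univ
    have h1 : σ (∏ i, δ i) = e (ψ σ) • ∏ i, δ i := by
      rw [hc, map_smul, hr, smul_comm]
    rw [← h1, map_prod]
    simp only [hm, hsmul]
    rw [Finset.prod_mul_distrib, ← map_prod, ← hsum]
    congr 1
    exact (Fintype.prod_equiv (Equiv.addRight (χ σ)) _ δ fun _ => rfl).symm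

/-- Kummer characters are homomorphisms. -/
theorem map_mul_of_smul_eq {p : ℕ} {F L : Type*} [Field F] [Field L] [Algebra F L]
    {e : AddChar (ZMod p) F} (hinj : ∀ c, e c = 1 → c = 0) {χ : (L ≃ₐ[F] L) → ZMod p} {r : L}
    (hr0 : r ≠ 0) (hr : ∀ σ, σ r = e (χ σ) • r) (σ τ : L ≃ₐ[F] L) :
    χ (σ * τ) = χ σ + χ τ := by
  have h := hr (σ * τ)
  rw [AlgEquiv.mul_apply, hr τ, map_smul, hr σ, smul_smul, ← AddChar.map_add_eq_mul,
    Algebra.smul_def, Algebra.smul_def, mul_left_inj' hr0, (algebraMap F L).injective.eq_iff] at h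
  refine sub_eq_zero.1 (hinj _ ?_)
  rw [AddChar.map_sub_eq_div, ← h, add_comm, div_self (e.val_isUnit _).ne_zero]

/-- Let `F` be a field containing a primitive `p`-th root of unity, `a, b ∈ F^×`
linearly independent modulo `(F^×)^p` with Kummer characters `χ_a, χ_b`, `k < p` a
positive integer, and assume `χ_a ∪ χ_b` is the coboundary of a continuous 1-cochain.
Then there is a complete defining system `{a_{ij} : 1 ≤ i < j ≤ k+3}` for the
`(k+2)`-tuple `(−χ_a, −χ_b, −χ_a, …, −χ_a)` (`k+1` copies of `−χ_a`) with
`a_{ij} = −(χ_a choose (j−i))` for all `3 ≤ i < j ≤ k+3`; in particular the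
`(k+2)`-fold Massey product `⟨−χ_a, −χ_b, −χ_a, …, −χ_a⟩` is defined and
contains `0`. -/
theorem massey_abaa_complete_defining_system (p : ℕ) [Fact p.Prime]
    (F Fs : Type*) [Field F] [Field Fs] [Algebra F Fs] [IsSepClosure F Fs]
    (ξ : F) (hξ : IsPrimitiveRoot ξ p)
    (a b : F) (ha : a ≠ 0) (hb : b ≠ 0) (hab : LinIndepModP p a b)
    (ra rb : Fs) (hra : ra ^ p = algebraMap F Fs a) (hrb : rb ^ p = algebraMap F Fs b)
    (χa χb : (Fs ≃ₐ[F] Fs) → ZMod p)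
    (hχa : IsKummerChar ξ ra χa) (hχb : IsKummerChar ξ rb χb)
    (hχa_cts : Cts χa) (hχb_cts : Cts χb)
    (k : ℕ) (hk1 : 1 ≤ k) (hkp : k < p)
    (hcup : ∃ φ : (Fs ≃ₐ[F] Fs) → ZMod p, Cts φ ∧
      ∀ σ τ : Fs ≃ₐ[F] Fs, φ σ + φ τ - φ (σ * τ) = χa σ * χb τ) :
    ∃ M : ℕ → ℕ → (Fs ≃ₐ[F] Fs) → ZMod p,
      IsCompleteDefiningSystem (k + 2)
        (fun i σ => if i = 2 then -χb σ else -χa σ) M ∧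
      ∀ i j, 3 ≤ i → i < j → j ≤ k + 3 →
        M i j = fun σ => -(zchoose (χa σ) (j - i)) := by
  have : IsGalois F Fs := IsSepClosure.isGalois
  obtain ⟨e, he, hinj⟩ := exists_addChar_of_isPrimitiveRoot hξ
  have hp0 : p ≠ 0 := (Fact.out : p.Prime).ne_zero
  have hξ' : IsPrimitiveRoot (algebraMap F Fs ξ) p := hξ.map_of_injective (algebraMap F Fs).injective
  have hroot : ∀ x y : Fs, y ≠ 0 → x ^ p = y ^ p → ∃ c, x = e c • y := by
    intro x y hy h
    obtain ⟨i, hi, hxy⟩ := hξ'.eq_pow_of_pow_eq_one (ξ := x / y)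
      (by rw [div_pow, h, div_self (pow_ne_zero p hy)])
    refine ⟨i, ?_⟩
    rw [Algebra.smul_def, he, map_pow, ZMod.val_cast_of_lt hi, hxy, div_mul_cancel₀ _ hy]
  have hra0 : ra ≠ 0 := by
    rintro rfl
    rw [zero_pow hp0] at hra
    exact ha ((map_eq_zero _).1 hra.symm)
  have hrb0 : rb ≠ 0 := by
    rintro rfl
    rw [zero_pow hp0] at hrb
    exact hb ((map_eq_zero _).1 hrb.symm)
  have hχa' : ∀ σ, σ ra = e (χa σ) • ra := fun σ => by
    rw [hχa σ, Algebra.smul_def, he, map_pow]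
  have hχb' : ∀ σ, σ rb = e (χb σ) • rb := fun σ => by
    rw [hχb σ, Algebra.smul_def, he, map_pow]
  have hmula := map_mul_of_smul_eq hinj hra0 hχa'
  have hmulb := map_mul_of_smul_eq hinj hrb0 hχb'
  obtain ⟨s₀, hs₀⟩ : ∃ s, χa s ≠ 0 := by
    by_contra! hzero
    have hbot : ra ∈ (⊥ : IntermediateField F Fs) :=
      (InfiniteGalois.mem_bot_iff_fixed ra).2 fun σ => by rw [hχa', hzero]; simp
    obtain ⟨y, rfl⟩ := IntermediateField.mem_bot.1 hbot
    rw [← map_pow, (algebraMap F Fs).injective.eq_iff] at hra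
    have hdvd := (hab 1 0 ⟨y, by rintro rfl; simp at hra0, by simp [← hra]⟩).1
    have := Int.le_of_dvd one_pos hdvd
    have := (Fact.out : p.Prime).two_le
    omega
  obtain ⟨s, hs⟩ : ∃ s, χa s = 1 := ⟨s₀ ^ ((χa s₀)⁻¹).val, by
    rw [apply_pow_of_map_mul hmula, ZMod.natCast_zmod_val, inv_mul_cancel₀ hs₀]⟩
  obtain ⟨φ, hφc, hφ⟩ := hcup
  obtain ⟨β, hβ0, hβ, hnorm⟩ := exists_norm_eq_of_cup_eq_coboundary e hmula
    hχa_cts.isLocallyConstant hmulb hrb0 hχb' hφc.isLocallyConstant hφ hs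
  obtain ⟨m, hm, hmc, hsum⟩ := exists_cocycle_of_norm_eq e hξ.neZero'.out hinj hroot hmula
    hχa_cts.isLocallyConstant hrb0 hχb' hs hβ0 hβ hnorm
  exact exists_completeDefiningSystem_of_cocycle hmula hχa_cts.isLocallyConstant hm hmc hsum hkp
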